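/- arXiv:2410.01616 — 2 statements merged into one kernel-verified Lean document; each statement's English description precedes it below -/
import Mathlib

section
/- Let g be a C² metric on U and V = (V_μ) a C² covector field on U satisfying the relativistic Euler equation in vector form ∇_V V^ν + (1/2)∇^ν‖V‖² = 0 on U, where (∇_V V)^ν := V^λ∇_λ V^ν and ∇^ν f := g^{νμ}∂_μ f. Then on U, for every ν: ∇_V² V^ν − (1/2)(∇^λ‖V‖²)(∇_λ V^ν) + (1/2)∇^ν(D_V‖V‖²) − (1/2)g^{μν}(∇^λ‖V‖²)ω_{μλ} = 0, where ∇_V² V^ν := V^μ∇_μ( V^λ∇_λ V^ν ) with the vector-field covariant derivative ∇_μ W^ν := ∂_μ W^ν + Γ^ν_{μκ}W^κ, and ∇_λ V^ν := ∂_λ V^ν + Γ^ν_{λκ}V^κ. -/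
noncomputable section

/-- Points of spacetime: coordinates (x⁰,x¹,x²,x³). -/
abbrev Vec4 : Type := Fin 4 → ℝ

/-- Partial derivative ∂_μ f. -/
def pd (μ : Fin 4) (f : Vec4 → ℝ) (x : Vec4) : ℝ := fderiv ℝ f x (Pi.single μ 1)

/-- Christoffel symbols Γ^l_{μν} of the metric g, with pointwise inverse ginv. -/
def Chris (g ginv : Vec4 → Fin 4 → Fin 4 → ℝ) (l μ ν : Fin 4) (x : Vec4) : ℝ :=
  (1 / 2) * ∑ κ, ginv x l κ *
    (pd μ (fun y => g y κ ν) x + pd ν (fun y => g y κ μ) x - pd κ (fun y => g y μ ν) x)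

/-- Raised index V^μ := g^{μν} V_ν. -/
def Vup (ginv : Vec4 → Fin 4 → Fin 4 → ℝ) (V : Vec4 → Fin 4 → ℝ) (μ : Fin 4) (x : Vec4) : ℝ :=
  ∑ ν, ginv x μ ν * V x ν

/-- ‖V‖² := −g^{μν} V_μ V_ν. -/
def normSq (ginv : Vec4 → Fin 4 → Fin 4 → ℝ) (V : Vec4 → Fin 4 → ℝ) (x : Vec4) : ℝ :=
  -∑ μ, ∑ ν, ginv x μ ν * V x μ * V x ν

/-- Vorticity two-form ω_{μν} := ∂_μ V_ν − ∂_ν V_μ. -/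
def vort (V : Vec4 → Fin 4 → ℝ) (μ ν : Fin 4) (x : Vec4) : ℝ :=
  pd μ (fun y => V y ν) x - pd ν (fun y => V y μ) x

/-- Covariant derivative of the raised velocity: ∇_μ V^l := ∂_μ V^l + Γ^l_{μκ} V^κ. -/
def covDup (g ginv : Vec4 → Fin 4 → Fin 4 → ℝ) (V : Vec4 → Fin 4 → ℝ) (μ l : Fin 4) (x : Vec4) : ℝ :=
  pd μ (fun y => Vup ginv V l y) x + ∑ κ, Chris g ginv l μ κ x * Vup ginv V κ x

/-- (∇_V V)^ν := V^λ ∇_λ V^ν. -/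
def nablaVV (g ginv : Vec4 → Fin 4 → Fin 4 → ℝ) (V : Vec4 → Fin 4 → ℝ) (ν : Fin 4) (x : Vec4) : ℝ :=
  ∑ l, Vup ginv V l x * covDup g ginv V l ν x

/-- ∇^l ‖V‖² := g^{lκ} ∂_κ ‖V‖². -/
def gradUpNorm (ginv : Vec4 → Fin 4 → Fin 4 → ℝ) (V : Vec4 → Fin 4 → ℝ) (l : Fin 4) (x : Vec4) : ℝ :=
  ∑ κ, ginv x l κ * pd κ (normSq ginv V) x

/-- D_V ‖V‖² := V^μ ∂_μ ‖V‖². -/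
def DVnorm (ginv : Vec4 → Fin 4 → Fin 4 → ℝ) (V : Vec4 → Fin 4 → ℝ) (x : Vec4) : ℝ :=
  ∑ μ, Vup ginv V μ x * pd μ (normSq ginv V) x

open Filter Topology in
theorem pd_congr {f h : Vec4 → ℝ} {x : Vec4} (e : f =ᶠ[𝓝 x] h) (m : Fin 4) :
    pd m f x = pd m h x := by
  unfold pd; rw [e.fderiv_eq]

theorem pd_mul {f h : Vec4 → ℝ} {x : Vec4} (hf : DifferentiableAt ℝ f x)
    (hh : DifferentiableAt ℝ h x) (m : Fin 4) :
    pd m (fun y => f y * h y) x = pd m f x * h x + f x * pd m h x := by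
  unfold pd
  rw [fderiv_fun_mul hf hh]
  simp
  ring

theorem pd_sum {f : Fin 4 → Vec4 → ℝ} {x : Vec4} (hf : ∀ i, DifferentiableAt ℝ (f i) x)
    (m : Fin 4) : pd m (fun y => ∑ i, f i y) x = ∑ i, pd m (f i) x := by
  unfold pd
  rw [fderiv_fun_sum (fun i _ => hf i)]
  simp

theorem pd_sum_mul {f h : Fin 4 → Vec4 → ℝ} {x : Vec4} (hf : ∀ i, DifferentiableAt ℝ (f i) x)
    (hh : ∀ i, DifferentiableAt ℝ (h i) x) (m : Fin 4) :
    pd m (fun y => ∑ i, f i y * h i y) x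
      = ∑ i, (pd m (f i) x * h i x + f i x * pd m (h i) x) := by
  rw [pd_sum (f := fun i y => f i y * h i y) (fun i => (hf i).mul (hh i))]
  exact Finset.sum_congr rfl fun i _ => pd_mul (hf i) (hh i) m

theorem pd_const_mul {f : Vec4 → ℝ} {x : Vec4} (c : ℝ) (hf : DifferentiableAt ℝ f x)
    (m : Fin 4) : pd m (fun y => c * f y) x = c * pd m f x := by
  unfold pd
  rw [fderiv_const_mul hf]
  simp

theorem pd_diff {f : Vec4 → ℝ} {x : Vec4} (hf : ContDiffAt ℝ 2 f x) (m : Fin 4) :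
    DifferentiableAt ℝ (pd m f) x := by
  have h1 : DifferentiableAt ℝ (fderiv ℝ f) x :=
    (hf.fderiv_right (m := 1) (by norm_num)).differentiableAt (by norm_num)
  exact h1.clm_apply (differentiableAt_const _)

theorem pd_pd {f : Vec4 → ℝ} {x : Vec4} (hf : ContDiffAt ℝ 2 f x) (a b : Fin 4) :
    pd a (pd b f) x = pd b (pd a f) x := by
  have h1 : DifferentiableAt ℝ (fderiv ℝ f) x :=
    (hf.fderiv_right (m := 1) (by norm_num)).differentiableAt (by norm_num)
  have key : ∀ a b : Fin 4, pd a (pd b f) x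
      = fderiv ℝ (fderiv ℝ f) x (Pi.single a 1) (Pi.single b 1) := by
    intro a b
    have : pd a (pd b f) x = fderiv ℝ (fun y => fderiv ℝ f y (Pi.single b 1)) x (Pi.single a 1) := rfl
    rw [this, fderiv_clm_apply h1 (differentiableAt_const _)]
    simp
  rw [key, key]
  exact (hf.isSymmSndFDerivAt (by simp)) _ _

theorem det_contDiffAt {M : Vec4 → Matrix (Fin 4) (Fin 4) ℝ} {x : Vec4}
    (h : ∀ i j, ContDiffAt ℝ 2 (fun y => M y i j) x) :
    ContDiffAt ℝ 2 (fun y => (M y).det) x := by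
  simp only [Matrix.det_apply']
  refine ContDiffAt.sum fun σ _ => contDiffAt_const.mul ?_
  exact contDiffAt_prod fun i _ => h _ _

open Filter Topology in
theorem ginv_contDiffAt {U : Set Vec4} (hU : IsOpen U) {g ginv : Vec4 → Fin 4 → Fin 4 → ℝ}
    (hinv : ∀ x ∈ U, ∀ μ ν, (∑ κ, g x μ κ * ginv x κ ν) = if μ = ν then 1 else 0)
    (hg : ∀ μ ν, ContDiffOn ℝ 2 (fun x => g x μ ν) U) {x : Vec4} (hx : x ∈ U) (a b : Fin 4) :
    ContDiffAt ℝ 2 (fun y => ginv y a b) x := by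
  have hg' : ∀ i j, ContDiffAt ℝ 2 (fun y => g y i j) x :=
    fun i j => (hg i j).contDiffAt (hU.mem_nhds hx)
  have hmul : ∀ y ∈ U, Matrix.of (g y) * Matrix.of (ginv y) = 1 := by
    intro y hy
    ext i j
    simp only [Matrix.mul_apply, Matrix.of_apply, Matrix.one_apply]
    exact hinv y hy i j
  have hdet : ∀ y ∈ U, (Matrix.of (g y)).det ≠ 0 := by
    intro y hy h0
    have := congrArg Matrix.det (hmul y hy)
    rw [Matrix.det_mul, h0] at this
    simp at this
  have heq : (fun y => ginv y a b) =ᶠ[𝓝 x]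
      fun y => ((Matrix.of (g y)).det)⁻¹ * (Matrix.of (g y)).adjugate a b := by
    filter_upwards [hU.mem_nhds hx] with y hy
    have h1 := Matrix.inv_eq_right_inv (hmul y hy)
    have h2 := congrFun (congrFun h1 a) b
    rw [Matrix.inv_def] at h2
    simpa using h2.symm
  refine ContDiffAt.congr_of_eventuallyEq ?_ heq
  refine ((det_contDiffAt ?_).inv (hdet x hx)).mul ?_
  · exact hg'
  · simp only [Matrix.adjugate_apply]
    refine det_contDiffAt fun i j => ?_
    simp only [Matrix.updateRow_apply]
    split_ifs
    · exact contDiffAt_const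
    · exact hg' i j

/-- Pure algebra at a point. -/
theorem point_algebra (H : Fin 4 → Fin 4 → ℝ) (dG dH : Fin 4 → Fin 4 → Fin 4 → ℝ)
    (V n v w : Fin 4 → ℝ) (dV nn : Fin 4 → Fin 4 → ℝ)
    (hH : ∀ a b, H a b = H b a) (hG : ∀ m a b, dG m a b = dG m b a)
    (hn : ∀ a b, nn a b = nn b a)
    (hdH : ∀ m a (u : Fin 4 → ℝ), ∑ b, dH m a b * u b
      = - ∑ k, H a k * ∑ d, dG m k d * ∑ b, H d b * u b)
    (hv : ∀ a, v a = ∑ b, H a b * V b) (hw : ∀ a, w a = ∑ b, H a b * n b) (ν : Fin 4) :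
    (∑ m, v m * ((-1/2) * (∑ k, (dH m ν k * n k + H ν k * nn m k))
        + ∑ c, ((1/2) * ∑ k, H ν k * (dG m k c + dG c k m - dG k m c)) * ((-1/2) * w c)))
      - (1/2) * (∑ l, w l * ((∑ b, (dH l ν b * V b + H ν b * dV l b))
        + ∑ c, ((1/2) * ∑ k, H ν k * (dG l k c + dG c k l - dG k l c)) * v c))
      + (1/2) * (∑ m, H ν m * ∑ a, ((∑ b, (dH m a b * V b + H a b * dV m b)) * n a + v a * nn m a))
      - (1/2) * (∑ m, ∑ l, H m ν * w l * (dV m l - dV l m)) = 0 := by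
  have hdV : ∀ m a, ∑ b, dH m a b * V b = - ∑ k, H a k * ∑ d, dG m k d * v d := by
    intro m a; rw [hdH]; simp only [hv]
  have hdn : ∀ m a, ∑ b, dH m a b * n b = - ∑ k, H a k * ∑ d, dG m k d * w d := by
    intro m a; rw [hdH]; simp only [hw]
  have hpair : ∀ X : Fin 4 → ℝ, ∑ a, (∑ k, H a k * X k) * n a = ∑ k, w k * X k := by
    intro X
    simp only [hw, Finset.sum_mul]
    rw [Finset.sum_comm]
    refine Finset.sum_congr rfl fun k _ => Finset.sum_congr rfl fun a _ => ?_
    rw [hH a k]; ring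
  have hΓ : ∀ m (u : Fin 4 → ℝ), ∑ c, ((1/2) * ∑ k, H ν k * (dG m k c + dG c k m - dG k m c)) * u c
      = ∑ k, H ν k * ∑ c, (1/2) * (dG m k c + dG c k m - dG k m c) * u c := by
    intro m u
    simp only [Finset.mul_sum, Finset.sum_mul]
    rw [Finset.sum_comm]
    refine Finset.sum_congr rfl fun k _ => Finset.sum_congr rfl fun a _ => ?_
    ring
  have hout : ∀ (p : Fin 4 → ℝ) (X : Fin 4 → Fin 4 → ℝ), ∑ m, p m * ∑ k, H ν k * X m k
      = ∑ k, H ν k * ∑ m, p m * X m k := by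
    intro p X
    simp only [Finset.mul_sum]
    rw [Finset.sum_comm]
    refine Finset.sum_congr rfl fun k _ => Finset.sum_congr rfl fun a _ => ?_
    ring
  -- first term
  have t1 : (∑ m, v m * ((-1/2) * (∑ k, (dH m ν k * n k + H ν k * nn m k))
        + ∑ c, ((1/2) * ∑ k, H ν k * (dG m k c + dG c k m - dG k m c)) * ((-1/2) * w c)))
      = ∑ k, H ν k * ∑ m, v m * ((1/2) * (∑ d, dG m k d * w d) - (1/2) * nn m k
          + ∑ c, (1/2) * (dG m k c + dG c k m - dG k m c) * ((-1/2) * w c)) := by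
    rw [← hout]
    refine Finset.sum_congr rfl fun m _ => ?_
    rw [hΓ m, Finset.sum_add_distrib, hdn]
    congr 1
    rw [← sub_eq_zero]
    simp only [mul_add, mul_sub, Finset.sum_add_distrib, Finset.sum_sub_distrib]
    have e1 : ∑ k, H ν k * (1/2 * ∑ d, dG m k d * w d) = (1/2) * ∑ k, H ν k * ∑ d, dG m k d * w d := by
      rw [Finset.mul_sum]; exact Finset.sum_congr rfl fun k _ => by ring
    have e2 : ∑ k, H ν k * (1/2 * nn m k) = (1/2) * ∑ k, H ν k * nn m k := by
      rw [Finset.mul_sum]; exact Finset.sum_congr rfl fun k _ => by ring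
    rw [e1, e2]; ring
  have t2 : (∑ l, w l * ((∑ b, (dH l ν b * V b + H ν b * dV l b))
        + ∑ c, ((1/2) * ∑ k, H ν k * (dG l k c + dG c k l - dG k l c)) * v c))
      = ∑ k, H ν k * ∑ l, w l * (-(∑ d, dG l k d * v d) + dV l k
          + ∑ c, (1/2) * (dG l k c + dG c k l - dG k l c) * v c) := by
    rw [← hout]
    refine Finset.sum_congr rfl fun m _ => ?_
    rw [hΓ m, Finset.sum_add_distrib, hdV]
    simp only [mul_add, mul_neg, Finset.sum_add_distrib, Finset.sum_neg_distrib]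
  have t3 : ∀ m, ∑ a, ((∑ b, (dH m a b * V b + H a b * dV m b)) * n a + v a * nn m a)
      = ∑ l, (w l * (-(∑ d, dG m l d * v d) + dV m l) + v l * nn m l) := by
    intro m
    rw [Finset.sum_add_distrib, Finset.sum_add_distrib, ← hpair]
    congr 1
    refine Finset.sum_congr rfl fun a _ => ?_
    rw [Finset.sum_add_distrib, hdV]
    simp only [mul_add, mul_neg, Finset.sum_add_distrib, Finset.sum_neg_distrib]
  have t4 : (∑ m, ∑ l, H m ν * w l * (dV m l - dV l m))
      = ∑ k, H ν k * ∑ l, w l * (dV k l - dV l k) := by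
    refine Finset.sum_congr rfl fun k _ => ?_
    rw [Finset.mul_sum]
    refine Finset.sum_congr rfl fun l _ => ?_
    rw [hH k ν]; ring
  rw [t1, t2, t4]
  simp only [t3]
  rw [Finset.mul_sum, Finset.mul_sum, Finset.mul_sum, ← Finset.sum_sub_distrib,
    ← Finset.sum_add_distrib, ← Finset.sum_sub_distrib]
  refine Finset.sum_eq_zero fun k _ => ?_
  -- collect the double sums
  have c1 : ∑ m, v m * ((1/2) * (∑ d, dG m k d * w d) - (1/2) * nn m k
          + ∑ c, (1/2) * (dG m k c + dG c k m - dG k m c) * ((-1/2) * w c))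
      = (∑ m, ∑ c, v m * w c * ((1/2) * dG m k c - (1/4) * (dG m k c + dG c k m - dG k m c)))
        - (1/2) * ∑ m, v m * nn k m := by
    rw [Finset.mul_sum, ← Finset.sum_sub_distrib]
    refine Finset.sum_congr rfl fun m _ => ?_
    rw [hn k m]
    simp only [Fin.sum_univ_four]; ring
  have c2 : ∑ l, w l * (-(∑ d, dG l k d * v d) + dV l k
          + ∑ c, (1/2) * (dG l k c + dG c k l - dG k l c) * v c)
      = (∑ m, ∑ c, v m * w c * (- dG c k m + (1/2) * (dG c k m + dG m k c - dG k m c)))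
        + ∑ l, w l * dV l k := by
    rw [Finset.sum_comm, ← Finset.sum_add_distrib]
    refine Finset.sum_congr rfl fun l _ => ?_
    simp only [Fin.sum_univ_four, hG k _ l]; ring
  have c3 : ∑ l, (w l * (-(∑ d, dG k l d * v d) + dV k l) + v l * nn k l)
      = (∑ m, ∑ c, v m * w c * (- dG k m c)) + (∑ l, w l * dV k l) + ∑ m, v m * nn k m := by
    rw [Finset.sum_comm, ← Finset.sum_add_distrib, ← Finset.sum_add_distrib]
    refine Finset.sum_congr rfl fun l _ => ?_
    simp only [Fin.sum_univ_four, hG k _ l]; ring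
  have c4 : ∑ l, w l * (dV k l - dV l k) = ∑ l, w l * dV k l - ∑ l, w l * dV l k := by
    simp only [mul_sub, Finset.sum_sub_distrib]
  rw [c1, c2, c3, c4]
  have c5 : (∑ m, ∑ c, v m * w c * ((1/2) * dG m k c - (1/4) * (dG m k c + dG c k m - dG k m c)))
      - (1/2) * (∑ m, ∑ c, v m * w c * (- dG c k m + (1/2) * (dG c k m + dG m k c - dG k m c)))
      + (1/2) * (∑ m, ∑ c, v m * w c * (- dG k m c)) = 0 := by
    simp only [Finset.mul_sum]
    rw [← Finset.sum_sub_distrib, ← Finset.sum_add_distrib]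
    refine Finset.sum_eq_zero fun m _ => ?_
    rw [← Finset.sum_sub_distrib, ← Finset.sum_add_distrib]
    refine Finset.sum_eq_zero fun c _ => ?_
    ring
  linear_combination H ν k * c5

/-- Equation (1.23): if V satisfies the Euler equation in vector form
∇_V V^ν + (1/2)∇^ν‖V‖² = 0, then
∇_V² V^ν − (1/2)(∇^λ‖V‖²)(∇_λ V^ν) + (1/2)∇^ν(D_V‖V‖²) − (1/2)g^{μν}(∇^λ‖V‖²)ω_{μλ} = 0. -/
theorem second_order_velocity_equation
    (U : Set Vec4) (hU : IsOpen U)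
    (g ginv : Vec4 → Fin 4 → Fin 4 → ℝ)
    (hsymm : ∀ x ∈ U, ∀ μ ν, g x μ ν = g x ν μ)
    (hinv : ∀ x ∈ U, ∀ μ ν, (∑ κ, g x μ κ * ginv x κ ν) = if μ = ν then 1 else 0)
    (hg : ∀ μ ν, ContDiffOn ℝ 2 (fun x => g x μ ν) U)
    (V : Vec4 → Fin 4 → ℝ)
    (hV : ∀ μ, ContDiffOn ℝ 2 (fun x => V x μ) U)
    (heuler : ∀ x ∈ U, ∀ ν,
      nablaVV g ginv V ν x + (1 / 2) * ∑ μ, ginv x ν μ * pd μ (normSq ginv V) x = 0) :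
    ∀ x ∈ U, ∀ ν,
      (∑ μ, Vup ginv V μ x *
          (pd μ (fun y => nablaVV g ginv V ν y) x
            + ∑ κ, Chris g ginv ν μ κ x * nablaVV g ginv V κ x))
        - (1 / 2) * (∑ l, gradUpNorm ginv V l x * covDup g ginv V l ν x)
        + (1 / 2) * (∑ μ, ginv x ν μ * pd μ (fun y => DVnorm ginv V y) x)
        - (1 / 2) * (∑ μ, ∑ l, ginv x μ ν * gradUpNorm ginv V l x * vort V μ l x) = 0 := by
  intro x hx ν
  have hnh : U ∈ nhds x := hU.mem_nhds hx
  have hgx : ∀ a b, DifferentiableAt ℝ (fun y => g y a b) x :=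
    fun a b => ((hg a b).contDiffAt hnh).differentiableAt (by norm_num)
  have hHc : ∀ a b, ContDiffAt ℝ 2 (fun y => ginv y a b) x :=
    fun a b => ginv_contDiffAt hU hinv hg hx a b
  have hHx : ∀ a b, DifferentiableAt ℝ (fun y => ginv y a b) x :=
    fun a b => (hHc a b).differentiableAt (by norm_num)
  have hVc : ∀ a, ContDiffAt ℝ 2 (fun y => V y a) x := fun a => (hV a).contDiffAt hnh
  have hVx : ∀ a, DifferentiableAt ℝ (fun y => V y a) x :=
    fun a => (hVc a).differentiableAt (by norm_num)
  have hN : ContDiffAt ℝ 2 (normSq ginv V) x := by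
    unfold normSq
    exact (ContDiffAt.sum fun a _ => ContDiffAt.sum fun b _ =>
      ((hHc a b).mul (hVc a)).mul (hVc b)).neg
  have hNx : ∀ a, DifferentiableAt ℝ (pd a (normSq ginv V)) x := pd_diff hN
  have hmul : Matrix.of (g x) * Matrix.of (ginv x) = 1 := by
    ext i j
    simp only [Matrix.mul_apply, Matrix.of_apply, Matrix.one_apply]
    exact hinv x hx i j
  have hmul' : Matrix.of (ginv x) * Matrix.of (g x) = 1 := mul_eq_one_comm.mp hmul
  have hHsymm : ∀ a b, ginv x a b = ginv x b a := by
    have hgs : (Matrix.of (g x)).transpose = Matrix.of (g x) := by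
      ext i j; exact hsymm x hx j i
    have h1 : (Matrix.of (ginv x)).transpose * Matrix.of (g x) = 1 := by
      have := congrArg Matrix.transpose hmul
      rwa [Matrix.transpose_mul, hgs, Matrix.transpose_one] at this
    have h2 : (Matrix.of (ginv x)).transpose = Matrix.of (ginv x) :=
      left_inv_eq_right_inv h1 hmul
    intro a b
    exact congrFun (congrFun h2 b) a
  have hGs : ∀ m a b, pd m (fun y => g y a b) x = pd m (fun y => g y b a) x := by
    intro m a b
    exact pd_congr (Filter.eventually_of_mem hnh fun y hy => hsymm y hy a b) m
  -- derivative of the inverse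
  have hdinv : ∀ m a b, ∑ k, (pd m (fun y => g y a k) x * ginv x k b
      + g x a k * pd m (fun y => ginv y k b) x) = 0 := by
    intro m a b
    rw [← pd_sum_mul (f := fun k y => g y a k) (h := fun k y => ginv y k b)
      (fun k => hgx a k) (fun k => hHx k b)]
    have e : pd m (fun y => ∑ k, g y a k * ginv y k b) x
        = pd m (fun _ => if a = b then (1 : ℝ) else 0) x :=
      pd_congr (Filter.eventually_of_mem hnh fun y hy => hinv y hy a b) m
    rw [e]
    simp [pd]
  have hdHm : ∀ m, Matrix.of (fun a b => pd m (fun y => ginv y a b) x)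
      = -(Matrix.of (ginv x) * (Matrix.of (fun a b => pd m (fun y => g y a b) x)
          * Matrix.of (ginv x))) := by
    intro m
    have h1 : Matrix.of (fun a b => pd m (fun y => g y a b) x) * Matrix.of (ginv x)
        + Matrix.of (g x) * Matrix.of (fun a b => pd m (fun y => ginv y a b) x) = 0 := by
      ext a b
      simp only [Matrix.add_apply, Matrix.mul_apply, Matrix.of_apply, Matrix.zero_apply]
      rw [← Finset.sum_add_distrib]
      exact hdinv m a b
    have h2 := congrArg (fun M => Matrix.of (ginv x) * M) h1
    simp only [mul_add, mul_zero] at h2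
    rw [← mul_assoc (Matrix.of (ginv x)) (Matrix.of (g x)), hmul', one_mul] at h2
    exact eq_neg_of_add_eq_zero_right h2
  have hdH : ∀ m a (u : Fin 4 → ℝ), ∑ b, pd m (fun y => ginv y a b) x * u b
      = - ∑ k, ginv x a k * ∑ d, pd m (fun y => g y k d) x * ∑ b, ginv x d b * u b := by
    intro m a u
    have h := congrFun (congrArg (fun M => Matrix.mulVec M u) (hdHm m)) a
    simp only [Matrix.neg_mulVec, ← Matrix.mulVec_mulVec, Pi.neg_apply] at h
    exact h
  -- derivatives of the raised velocity etc.
  have hVup : ∀ a, DifferentiableAt ℝ (fun y => Vup ginv V a y) x := by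
    intro a
    unfold Vup
    exact DifferentiableAt.fun_sum fun b _ => (hHx a b).mul (hVx b)
  have hdVup : ∀ m a, pd m (fun y => Vup ginv V a y) x
      = ∑ b, (pd m (fun y => ginv y a b) x * V x b + ginv x a b * pd m (fun y => V y b) x) :=
    fun m a => pd_sum_mul (f := fun b y => ginv y a b) (h := fun b y => V y b)
      (fun b => hHx a b) hVx m
  have hnab : ∀ c, nablaVV g ginv V c x = (-1/2) * gradUpNorm ginv V c x := by
    intro c
    have := heuler x hx c
    unfold gradUpNorm
    linarith
  have hdnab : ∀ m, pd m (fun y => nablaVV g ginv V ν y) x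
      = (-1/2) * ∑ k, (pd m (fun y => ginv y ν k) x * pd k (normSq ginv V) x
          + ginv x ν k * pd m (pd k (normSq ginv V)) x) := by
    intro m
    rw [← pd_sum_mul (f := fun k y => ginv y ν k) (h := fun k => pd k (normSq ginv V))
      (fun k => hHx ν k) hNx, ← pd_const_mul]
    · refine pd_congr (Filter.eventually_of_mem hnh fun y hy => ?_) m
      have := heuler y hy ν
      show nablaVV g ginv V ν y = _
      linarith
    · exact DifferentiableAt.fun_sum fun b _ => (hHx ν b).mul (hNx b)
  have hdD : ∀ m, pd m (fun y => DVnorm ginv V y) x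
      = ∑ a, ((∑ b, (pd m (fun y => ginv y a b) x * V x b
            + ginv x a b * pd m (fun y => V y b) x)) * pd a (normSq ginv V) x
          + Vup ginv V a x * pd m (pd a (normSq ginv V)) x) := by
    intro m
    simp only [← hdVup]
    exact pd_sum_mul (f := fun a y => Vup ginv V a y) (h := fun a => pd a (normSq ginv V))
      hVup hNx m
  have key := point_algebra (ginv x) (fun m a b => pd m (fun y => g y a b) x)
    (fun m a b => pd m (fun y => ginv y a b) x) (V x) (fun a => pd a (normSq ginv V) x)
    (fun a => Vup ginv V a x) (fun a => gradUpNorm ginv V a x)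
    (fun m b => pd m (fun y => V y b) x) (fun m a => pd m (pd a (normSq ginv V)) x)
    hHsymm hGs (fun a b => pd_pd hN a b) hdH (fun _ => rfl) (fun _ => rfl) ν
  simp only [hdnab, hnab, hdD, covDup, hdVup, vort, Chris]
  exact key
end
end

section
/- Let e_I : U → ℝ⁴ (I = 0,1,2,3) be C¹ maps, Θ̂^I : U → ℝ functions with Θ̂⁰ ≠ 0 everywhere and e_0^μ = (δ₀^μ − Θ̂^Ĩ e_Ĩ^μ)/Θ̂⁰, and let Γ_{IJ}^K : U → ℝ be arbitrary continuous functions. Define g^{μν} := ε_I e_I^μ e_I^ν, the spatial elliptic operator Ā u := Σ_{i,j=1}^{3} g^{ij} ∂_i∂_j u, and the frame wave operator □u := ε_I( D_I(D_I u) − Γ_{II}^K D_K u ). Then for every C² scalar u : U → ℝ, pointwise on U: Ā u = □u + [ (1 − Θ̂^Ĩ e_Ĩ⁰)²/(Θ̂⁰)² − Σ_{Ĩ=1}^{3}(e_Ĩ⁰)² ] ∂_t² u − 2 Σ_{i=1}^{3} [ e_Ĩ^i e_Ĩ⁰ + (1 − Θ̂^J̃ e_J̃⁰) Θ̂^Ĩ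 e_Ĩ^i /(Θ̂⁰)² ] ∂_i∂_t u − ε_I (D_I e_I^μ) ∂_μ u + ε_I Γ_{II}^K e_K^μ ∂_μ u. -/
noncomputable section

/-- Frame derivative D_I f := e_I^μ ∂_μ f. -/
def DI (e : Fin 4 → Vec4 → Fin 4 → ℝ) (I : Fin 4) (f : Vec4 → ℝ) (x : Vec4) : ℝ :=
  ∑ μ, e I x μ * pd μ f x

/-- Signs ε₀ = −1, ε_Ĩ = 1 for Ĩ = 1,2,3. -/
def eps (I : Fin 4) : ℝ := if I = 0 then -1 else 1

/-- The spatial indices {1,2,3} inside Fin 4. -/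
def spatial : Finset (Fin 4) := {1, 2, 3}

theorem pd_differentiableAt {u : Vec4 → ℝ} {x : Vec4} (hu : ContDiffAt ℝ 2 u x) (ν : Fin 4) :
    DifferentiableAt ℝ (pd ν u) x := by
  have h : DifferentiableAt ℝ (fderiv ℝ u) x :=
    (hu.fderiv_right (m := 1) (by norm_num)).differentiableAt (by norm_num)
  exact h.clm_apply (differentiableAt_const _)

theorem pd_comm {u : Vec4 → ℝ} {x : Vec4} (hu : ContDiffAt ℝ 2 u x) (μ ν : Fin 4) :
    pd μ (pd ν u) x = pd ν (pd μ u) x := by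
  have h : DifferentiableAt ℝ (fderiv ℝ u) x :=
    (hu.fderiv_right (m := 1) (by norm_num)).differentiableAt (by norm_num)
  have key : ∀ a b : Fin 4, pd a (pd b u) x
      = fderiv ℝ (fderiv ℝ u) x (Pi.single a 1) (Pi.single b 1) := by
    intro a b
    have h2 := (h.hasFDerivAt.clm_apply (hasFDerivAt_const (Pi.single b (1 : ℝ) : Vec4) x)).fderiv
    change fderiv ℝ (fun y => fderiv ℝ u y (Pi.single b 1)) x (Pi.single a 1) = _
    rw [h2]
    simp
  rw [key, key]
  exact (hu.isSymmSndFDerivAt (by simp)).eq _ _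

theorem DI_DI {e : Fin 4 → Vec4 → Fin 4 → ℝ} {u : Vec4 → ℝ} {x : Vec4}
    (hu : ContDiffAt ℝ 2 u x) (I : Fin 4)
    (he : ∀ μ, DifferentiableAt ℝ (fun y => e I y μ) x) :
    DI e I (fun y => DI e I u y) x
      = (∑ μ, ∑ ν, e I x μ * e I x ν * pd μ (pd ν u) x)
        + ∑ ν, DI e I (fun y => e I y ν) x * pd ν u x := by
  have key : ∀ μ, pd μ (fun y => DI e I u y) x
      = ∑ ν, (e I x ν * pd μ (pd ν u) x + pd ν u x * pd μ (fun y => e I y ν) x) := by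
    intro μ
    have h := (HasFDerivAt.fun_sum (u := Finset.univ) fun ν _ =>
      (he ν).hasFDerivAt.mul (pd_differentiableAt hu ν).hasFDerivAt).fderiv
    change fderiv ℝ (fun y => ∑ ν, e I y ν * pd ν u y) x (Pi.single μ 1) = _
    have h' : fderiv ℝ (fun y => ∑ ν, e I y ν * pd ν u y) x = _ := h
    rw [h']
    simp [pd]
  rw [DI]
  simp only [key]
  simp only [DI, Fin.sum_univ_four]
  ring

/-- Lemma 2.10: decomposition of the frame wave operator
□u := ε_I(D_I(D_I u) − Γ_{II}^K D_K u) against the spatial elliptic operator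
Ā u := Σ_{i,j=1}^3 g^{ij} ∂_i∂_j u, where g^{μν} = ε_I e_I^μ e_I^ν. -/
theorem wave_operator_elliptic_decomposition
    (U : Set Vec4) (hU : IsOpen U)
    (e : Fin 4 → Vec4 → Fin 4 → ℝ)
    (Θ : Fin 4 → Vec4 → ℝ)
    (Γc : Fin 4 → Fin 4 → Fin 4 → Vec4 → ℝ)
    (he : ∀ I μ, ContDiffOn ℝ 1 (fun x => e I x μ) U)
    (hΓ : ∀ I J K, ContinuousOn (Γc I J K) U)
    (hΘ0 : ∀ x ∈ U, Θ 0 x ≠ 0)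
    (he0 : ∀ x ∈ U, ∀ μ,
      e 0 x μ = ((if μ = 0 then 1 else 0) - ∑ i ∈ spatial, Θ i x * e i x μ) / Θ 0 x)
    (u : Vec4 → ℝ) (hu : ContDiffOn ℝ 2 u U) :
    ∀ x ∈ U,
      (∑ i ∈ spatial, ∑ j ∈ spatial,
          (∑ I, eps I * e I x i * e I x j) * pd i (pd j u) x)
        = (∑ I, eps I * (DI e I (fun y => DI e I u y) x - ∑ K, Γc I I K x * DI e K u x))
          + ((1 - ∑ i ∈ spatial, Θ i x * e i x 0) ^ 2 / (Θ 0 x) ^ 2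
              - ∑ i ∈ spatial, (e i x 0) ^ 2) * pd 0 (pd 0 u) x
          - 2 * (∑ i ∈ spatial,
              ((∑ j ∈ spatial, e j x i * e j x 0)
                + (1 - ∑ l ∈ spatial, Θ l x * e l x 0)
                    * (∑ j ∈ spatial, Θ j x * e j x i) / (Θ 0 x) ^ 2)
                * pd i (pd 0 u) x)
          - (∑ I, eps I * ∑ μ, DI e I (fun y => e I y μ) x * pd μ u x)
          + ∑ I, eps I * ∑ K, Γc I I K x * ∑ μ, e K x μ * pd μ u x := by
  intro x hx
  have hux : ContDiffAt ℝ 2 u x := hu.contDiffAt (hU.mem_nhds hx)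
  have hex : ∀ I μ, DifferentiableAt ℝ (fun y => e I y μ) x := fun I μ =>
    ((he I μ).contDiffAt (hU.mem_nhds hx)).differentiableAt (by norm_num)
  have hT := hΘ0 x hx
  have hDD := fun I => DI_DI hux I (hex I)
  have h0 : (1 - ∑ i ∈ spatial, Θ i x * e i x 0) = e 0 x 0 * Θ 0 x := by
    rw [he0 x hx 0]; field_simp; simp
  have hi : ∀ i : Fin 4, i ≠ 0 → (∑ j ∈ spatial, Θ j x * e j x i) = - (e 0 x i * Θ 0 x) := by
    intro i hi
    rw [he0 x hx i]; field_simp; simp [hi]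
  have hsum : ∀ f : Fin 4 → ℝ, ∑ i ∈ spatial, f i = f 1 + f 2 + f 3 := by
    intro f; simp [spatial, add_assoc]
  have hsq : (e 0 x 0 * Θ 0 x) ^ 2 / Θ 0 x ^ 2 = e 0 x 0 ^ 2 := by field_simp
  have hcr : ∀ i, e 0 x 0 * Θ 0 x * (- (e 0 x i * Θ 0 x)) / Θ 0 x ^ 2
      = - (e 0 x 0 * e 0 x i) := by intro i; field_simp
  rw [h0, hsq]
  have hS : (∑ i ∈ spatial, ((∑ j ∈ spatial, e j x i * e j x 0)
        + e 0 x 0 * Θ 0 x * (∑ j ∈ spatial, Θ j x * e j x i) / (Θ 0 x) ^ 2)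
          * pd i (pd 0 u) x)
      = ∑ i ∈ spatial, ((∑ j ∈ spatial, e j x i * e j x 0)
        - e 0 x 0 * e 0 x i) * pd i (pd 0 u) x := by
    refine Finset.sum_congr rfl fun i h => ?_
    have : i ≠ 0 := by rintro rfl; simp [spatial] at h
    rw [hi i this, hcr, sub_eq_add_neg]
  rw [hS]
  have hG : ∀ I K, Γc I I K x * DI e K u x = Γc I I K x * ∑ μ, e K x μ * pd μ u x :=
    fun _ _ => rfl
  simp only [hDD, hG, mul_sub, mul_add, Finset.sum_sub_distrib, Finset.sum_add_distrib]
  have e0 : eps 0 = -1 := by simp [eps]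
  have e1 : eps 1 = 1 := by simp [eps]
  have e2 : eps 2 = 1 := by simp [eps]
  have e3 : eps 3 = 1 := by simp [eps]
  generalize (∑ I, eps I * ∑ μ, DI e I (fun y => e I y μ) x * pd μ u x) = A
  generalize (∑ I, eps I * ∑ K, Γc I I K x * ∑ μ, e K x μ * pd μ u x) = B
  simp only [hsum, Fin.sum_univ_four, e0, e1, e2, e3]
  rw [pd_comm hux 0 1, pd_comm hux 0 2, pd_comm hux 0 3]
  ring
end
end
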